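/- Craig's and Lyndon's interpolation for PL(∨∨): if φ ⊨ ψ for PL(∨∨) formulas φ, ψ, then there is a PL(∨∨) formula θ such that φ ⊨ θ, θ ⊨ ψ, P⁺(θ) ⊆ P⁺(φ) ∩ P⁺(ψ), and P⁻(θ) ⊆ P⁻(φ) ∩ P⁻(ψ). -/

import Mathlib

/-! Basic propositional team logic PL(∨∨): syntax, team semantics,
resolutions, and the sequent calculi GT, G3cp, GT'. -/

/-- Valuations over a countably infinite set of propositional variables (ℕ). -/
abbrev Val : Type := ℕ → Bool

/-- A team is a set of valuations. -/
abbrev Team : Type := Set Val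

/-- Formulas; PL(∨∨) formulas are the well-formed (`WF`) ones, in which
negation is applied only to classical formulas. `disj` is the split
disjunction ∨ and `idisj` the inquisitive disjunction ∨∨. -/
inductive Form : Type where
  | var : ℕ → Form
  | bot : Form
  | neg : Form → Form
  | conj : Form → Form → Form
  | disj : Form → Form → Form
  | idisj : Form → Form → Form

namespace Form

/-- Classical (CPL) formulas: no inquisitive disjunction. -/
def IsClassical : Form → Prop
  | var _ => True
  | bot => True
  | neg α => IsClassical α
  | conj α β => IsClassical α ∧ IsClassical β
  | disj α β => IsClassical α ∧ IsClassical β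
  | idisj _ _ => False

/-- Well-formed formulas = formulas of PL(∨∨): negation applies only to
classical formulas. -/
def WF : Form → Prop
  | var _ => True
  | bot => True
  | neg α => IsClassical α
  | conj φ ψ => WF φ ∧ WF ψ
  | disj φ ψ => WF φ ∧ WF ψ
  | idisj φ ψ => WF φ ∧ WF ψ

/-- Team satisfaction. -/
def Sat : Form → Team → Prop
  | var p, t => ∀ v ∈ t, v p = true
  | bot, t => t = ∅
  | neg α, t => ∀ v ∈ t, ¬ Sat α {v}
  | conj φ ψ, t => Sat φ t ∧ Sat ψ t
  | disj φ ψ, t => ∃ s u : Team, t = s ∪ u ∧ Sat φ s ∧ Sat ψ u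
  | idisj φ ψ, t => Sat φ t ∨ Sat ψ t

/-- Single-valuation (classical) satisfaction, for classical formulas. -/
def CSat : Form → Val → Prop
  | var p, v => v p = true
  | bot, _ => False
  | neg α, v => ¬ CSat α v
  | conj α β, v => CSat α v ∧ CSat β v
  | disj α β, v => CSat α v ∨ CSat β v
  | idisj _ _, _ => False

/-- The set of resolutions of a formula. -/
def res : Form → Set Form
  | var p => {var p}
  | bot => {bot}
  | neg α => Form.neg '' res α
  | conj φ ψ => Set.image2 Form.conj (res φ) (res ψ)
  | disj φ ψ => Set.image2 Form.disj (res φ) (res ψ)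
  | idisj φ ψ => res φ ∪ res ψ

/-- Propositional variables occurring in a formula. -/
def vars : Form → Set ℕ
  | var p => {p}
  | bot => ∅
  | neg α => vars α
  | conj φ ψ => vars φ ∪ vars ψ
  | disj φ ψ => vars φ ∪ vars ψ
  | idisj φ ψ => vars φ ∪ vars ψ

/-- Signed occurrences: `svars φ true` = positively occurring variables,
`svars φ false` = negatively occurring variables. -/
def svars : Form → Bool → Set ℕ
  | var p, b => if b then {p} else ∅
  | bot, _ => ∅
  | neg α, b => svars α (!b)
  | conj φ ψ, b => svars φ b ∪ svars ψ b
  | disj φ ψ, b => svars φ b ∪ svars ψ b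
  | idisj φ ψ, b => svars φ b ∪ svars ψ b

/-- Positively occurring variables P⁺(φ). -/
def pvars (φ : Form) : Set ℕ := φ.svars true

/-- Negatively occurring variables P⁻(φ). -/
def nvars (φ : Form) : Set ℕ := φ.svars false

end Form

/-- `t ⊨ Γ`: every formula of the multiset Γ is satisfied by `t`. -/
def SatAll (t : Team) (Γ : Multiset Form) : Prop := ∀ φ ∈ Γ, Form.Sat φ t

/-- Team entailment Γ ⊨ φ. -/
def Entails (Γ : Multiset Form) (φ : Form) : Prop :=
  ∀ t : Team, SatAll t Γ → Form.Sat φ t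

/-- Resolutions R(Γ) of a multiset of formulas: images of Γ under resolution
functions. -/
def mres (Γ : Multiset Form) : Set (Multiset Form) :=
  {Ξ | ∃ f : Form → Form, (∀ φ ∈ Γ, f φ ∈ Form.res φ) ∧ Ξ = Γ.map f}

/-- Variables occurring in a multiset of formulas. -/
def mvars (Γ : Multiset Form) : Set ℕ := {p | ∃ φ ∈ Γ, p ∈ Form.vars φ}

/-- P⁺(Γ). -/
def mpvars (Γ : Multiset Form) : Set ℕ := {p | ∃ φ ∈ Γ, p ∈ Form.pvars φ}

/-- P⁻(Γ). -/
def mnvars (Γ : Multiset Form) : Set ℕ := {p | ∃ φ ∈ Γ, p ∈ Form.nvars φ}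

/-- The split disjunction ⋁Δ of a multiset (⊥ for the empty multiset).
(Satisfaction is invariant under the order of the chosen list.) -/
noncomputable def bigVee (Δ : Multiset Form) : Form :=
  Δ.toList.foldr Form.disj Form.bot

/-- One-hole formula contexts in which the hole does not occur in the scope
of a negation; these represent the subformula occurrences to which the
deep-inference rules may be applied. -/
inductive Ctx : Type where
  | hole : Ctx
  | conjL : Ctx → Form → Ctx
  | conjR : Form → Ctx → Ctx
  | disjL : Ctx → Form → Ctx
  | disjR : Form → Ctx → Ctx
  | idisjL : Ctx → Form → Ctx
  | idisjR : Form → Ctx → Ctx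

/-- Plugging a formula into a context: χ{η}. -/
def Ctx.fill : Ctx → Form → Form
  | .hole, η => η
  | .conjL c ψ, η => Form.conj (c.fill η) ψ
  | .conjR ψ c, η => Form.conj ψ (c.fill η)
  | .disjL c ψ, η => Form.disj (c.fill η) ψ
  | .disjR ψ c, η => Form.disj ψ (c.fill η)
  | .idisjL c ψ, η => Form.idisj (c.fill η) ψ
  | .idisjR ψ c, η => Form.idisj ψ (c.fill η)

/-- The sequent calculus GT. `GT c n Γ Δ` means: the sequent Γ ⇒ Δ has a
derivation of height at most `n`, using Cut only if `c = true`.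
So `∃ n, GT true n Γ Δ` is derivability in GT, `∃ n, GT false n Γ Δ` is
derivability in the cut-free fragment GT⁻, and `GT false n Γ Δ` is
`⊢ⁿ Γ ⇒ Δ` (cut-free derivability with height at most n). -/
inductive GT : Bool → ℕ → Multiset Form → Multiset Form → Prop
  | ax (c : Bool) (n : ℕ) (Γ Δ : Multiset Form) (p : ℕ) :
      GT c (n + 1) (Form.var p ::ₘ Γ) (Form.var p ::ₘ Δ)
  | lbot (c : Bool) (n : ℕ) (Γ Δ : Multiset Form) :
      GT c (n + 1) (Form.bot ::ₘ Γ) Δ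
  | lneg (c : Bool) (n : ℕ) (Γ Δ : Multiset Form) (α : Form) :
      Form.IsClassical α → GT c n Γ (α ::ₘ Δ) →
      GT c (n + 1) (Form.neg α ::ₘ Γ) Δ
  | rneg (c : Bool) (n : ℕ) (Γ Δ : Multiset Form) (α : Form) :
      Form.IsClassical α → GT c n (α ::ₘ Γ) Δ →
      GT c (n + 1) Γ (Form.neg α ::ₘ Δ)
  | lconj (c : Bool) (n : ℕ) (Γ Δ : Multiset Form) (φ ψ : Form) :
      GT c n (φ ::ₘ ψ ::ₘ Γ) Δ →
      GT c (n + 1) (Form.conj φ ψ ::ₘ Γ) Δ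
  | rconj (c : Bool) (n : ℕ) (Γ Λ Δ : Multiset Form) (φ ψ : Form) :
      (∀ γ ∈ Λ, Form.IsClassical γ) →
      GT c n Γ (φ ::ₘ Λ) → GT c n Γ (ψ ::ₘ Λ) →
      GT c (n + 1) Γ (Form.conj φ ψ ::ₘ (Λ + Δ))
  | ldisj (c : Bool) (n : ℕ) (Γ Λ Δ : Multiset Form) (φ ψ : Form) :
      (∀ γ ∈ Λ, Form.IsClassical γ) →
      GT c n (φ ::ₘ Γ) Λ → GT c n (ψ ::ₘ Γ) Λ →
      GT c (n + 1) (Form.disj φ ψ ::ₘ Γ) (Λ + Δ)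
  | rdisj (c : Bool) (n : ℕ) (Γ Δ : Multiset Form) (φ ψ : Form) :
      GT c n Γ (φ ::ₘ ψ ::ₘ Δ) →
      GT c (n + 1) Γ (Form.disj φ ψ ::ₘ Δ)
  | lidisj (c : Bool) (n : ℕ) (Γ Δ : Multiset Form) (χ : Ctx) (φL φR : Form) :
      GT c n (χ.fill φL ::ₘ Γ) Δ → GT c n (χ.fill φR ::ₘ Γ) Δ →
      GT c (n + 1) (χ.fill (Form.idisj φL φR) ::ₘ Γ) Δ
  | ridisjL (c : Bool) (n : ℕ) (Γ Δ : Multiset Form) (χ : Ctx) (φL φR : Form) :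
      GT c n Γ (χ.fill φL ::ₘ Δ) →
      GT c (n + 1) Γ (χ.fill (Form.idisj φL φR) ::ₘ Δ)
  | ridisjR (c : Bool) (n : ℕ) (Γ Δ : Multiset Form) (χ : Ctx) (φL φR : Form) :
      GT c n Γ (χ.fill φR ::ₘ Δ) →
      GT c (n + 1) Γ (χ.fill (Form.idisj φL φR) ::ₘ Δ)
  | cut (n : ℕ) (Γ Δ Θ S : Multiset Form) (φ : Form) :
      GT true n Γ (φ ::ₘ Δ) → GT true n (φ ::ₘ Θ) S →
      GT true (n + 1) (Γ + Θ) (Δ + S)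

/-- The classical sequent calculus G3cp (on classical formulas).
`G3 false` is its cut-free fragment G3cp⁻. -/
inductive G3 : Bool → Multiset Form → Multiset Form → Prop
  | ax (c : Bool) (Γ Δ : Multiset Form) (p : ℕ) :
      (∀ α ∈ Γ, Form.IsClassical α) → (∀ α ∈ Δ, Form.IsClassical α) →
      G3 c (Form.var p ::ₘ Γ) (Form.var p ::ₘ Δ)
  | lbot (c : Bool) (Γ Δ : Multiset Form) :
      (∀ α ∈ Γ, Form.IsClassical α) → (∀ α ∈ Δ, Form.IsClassical α) →
      G3 c (Form.bot ::ₘ Γ) Δ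
  | lneg (c : Bool) (Γ Δ : Multiset Form) (α : Form) :
      Form.IsClassical α → G3 c Γ (α ::ₘ Δ) → G3 c (Form.neg α ::ₘ Γ) Δ
  | rneg (c : Bool) (Γ Δ : Multiset Form) (α : Form) :
      Form.IsClassical α → G3 c (α ::ₘ Γ) Δ → G3 c Γ (Form.neg α ::ₘ Δ)
  | lconj (c : Bool) (Γ Δ : Multiset Form) (α β : Form) :
      G3 c (α ::ₘ β ::ₘ Γ) Δ → G3 c (Form.conj α β ::ₘ Γ) Δ
  | rconj (c : Bool) (Γ Λ Δ : Multiset Form) (α β : Form) :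
      (∀ γ ∈ Λ, Form.IsClassical γ) → (∀ γ ∈ Δ, Form.IsClassical γ) →
      G3 c Γ (α ::ₘ Λ) → G3 c Γ (β ::ₘ Λ) →
      G3 c Γ (Form.conj α β ::ₘ (Λ + Δ))
  | ldisj (c : Bool) (Γ Λ Δ : Multiset Form) (α β : Form) :
      (∀ γ ∈ Λ, Form.IsClassical γ) → (∀ γ ∈ Δ, Form.IsClassical γ) →
      G3 c (α ::ₘ Γ) Λ → G3 c (β ::ₘ Γ) Λ →
      G3 c (Form.disj α β ::ₘ Γ) (Λ + Δ)
  | rdisj (c : Bool) (Γ Δ : Multiset Form) (α β : Form) :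
      G3 c Γ (α ::ₘ β ::ₘ Δ) → G3 c Γ (Form.disj α β ::ₘ Δ)
  | cut (Γ Δ Θ S : Multiset Form) (α : Form) :
      Form.IsClassical α →
      G3 true Γ (α ::ₘ Δ) → G3 true (α ::ₘ Θ) S →
      G3 true (Γ + Θ) (Δ + S)

/-- The cut-free variant calculus GT'⁻: GT⁻ with independent-context rules
R∧', L∨' in place of R∧, L∨, plus explicit contraction rules LC and RC
(RC restricted to classical formulas). -/
inductive GTp : Multiset Form → Multiset Form → Prop
  | ax (Γ Δ : Multiset Form) (p : ℕ) :
      GTp (Form.var p ::ₘ Γ) (Form.var p ::ₘ Δ)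
  | lbot (Γ Δ : Multiset Form) : GTp (Form.bot ::ₘ Γ) Δ
  | lneg (Γ Δ : Multiset Form) (α : Form) :
      Form.IsClassical α → GTp Γ (α ::ₘ Δ) → GTp (Form.neg α ::ₘ Γ) Δ
  | rneg (Γ Δ : Multiset Form) (α : Form) :
      Form.IsClassical α → GTp (α ::ₘ Γ) Δ → GTp Γ (Form.neg α ::ₘ Δ)
  | lconj (Γ Δ : Multiset Form) (φ ψ : Form) :
      GTp (φ ::ₘ ψ ::ₘ Γ) Δ → GTp (Form.conj φ ψ ::ₘ Γ) Δ
  | rconj (Γ₁ Γ₂ Δ₁ Δ₂ : Multiset Form) (φ ψ : Form) :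
      GTp Γ₁ (φ ::ₘ Δ₁) → GTp Γ₂ (ψ ::ₘ Δ₂) →
      GTp (Γ₁ + Γ₂) (Form.conj φ ψ ::ₘ (Δ₁ + Δ₂))
  | ldisj (Γ₁ Γ₂ Δ₁ Δ₂ : Multiset Form) (φ ψ : Form) :
      GTp (φ ::ₘ Γ₁) Δ₁ → GTp (ψ ::ₘ Γ₂) Δ₂ →
      GTp (Form.disj φ ψ ::ₘ (Γ₁ + Γ₂)) (Δ₁ + Δ₂)
  | rdisj (Γ Δ : Multiset Form) (φ ψ : Form) :
      GTp Γ (φ ::ₘ ψ ::ₘ Δ) → GTp Γ (Form.disj φ ψ ::ₘ Δ)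
  | lidisj (Γ Δ : Multiset Form) (χ : Ctx) (φL φR : Form) :
      GTp (χ.fill φL ::ₘ Γ) Δ → GTp (χ.fill φR ::ₘ Γ) Δ →
      GTp (χ.fill (Form.idisj φL φR) ::ₘ Γ) Δ
  | ridisjL (Γ Δ : Multiset Form) (χ : Ctx) (φL φR : Form) :
      GTp Γ (χ.fill φL ::ₘ Δ) → GTp Γ (χ.fill (Form.idisj φL φR) ::ₘ Δ)
  | ridisjR (Γ Δ : Multiset Form) (χ : Ctx) (φL φR : Form) :
      GTp Γ (χ.fill φR ::ₘ Δ) → GTp Γ (χ.fill (Form.idisj φL φR) ::ₘ Δ)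
  | lc (Γ Δ : Multiset Form) (φ : Form) :
      GTp (φ ::ₘ φ ::ₘ Γ) Δ → GTp (φ ::ₘ Γ) Δ
  | rc (Γ Δ : Multiset Form) (α : Form) :
      Form.IsClassical α → GTp Γ (α ::ₘ α ::ₘ Δ) → GTp Γ (α ::ₘ Δ)

namespace Form

theorem IsClassical.wf {α : Form} (h : α.IsClassical) : α.WF := by
  induction α with
  | var | bot => trivial
  | neg => exact h
  | conj _ _ ih₁ ih₂ | disj _ _ ih₁ ih₂ => exact ⟨ih₁ h.1, ih₂ h.2⟩
  | idisj => exact h.elim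

theorem sat_empty (φ : Form) : φ.Sat ∅ := by
  induction φ with
  | var | neg => simp [Sat]
  | bot => rfl
  | conj _ _ ih₁ ih₂ => exact ⟨ih₁, ih₂⟩
  | disj _ _ ih₁ ih₂ => exact ⟨∅, ∅, by simp, ih₁, ih₂⟩
  | idisj _ _ ih₁ => exact Or.inl ih₁

/-- Classical formulas are flat. -/
theorem IsClassical.sat_iff {α : Form} (h : α.IsClassical) (t : Team) :
    α.Sat t ↔ ∀ v ∈ t, α.CSat v := by
  induction α generalizing t with
  | var => rfl
  | bot => exact Set.eq_empty_iff_forall_notMem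
  | neg α ih => simp [Sat, CSat, ih h]
  | conj α β ihα ihβ =>
    simp only [Sat, CSat, ihα h.1, ihβ h.2]
    exact ⟨fun H v hv => ⟨H.1 v hv, H.2 v hv⟩,
      fun H => ⟨fun v hv => (H v hv).1, fun v hv => (H v hv).2⟩⟩
  | disj α β ihα ihβ =>
    simp only [Sat, CSat, ihα h.1, ihβ h.2]
    constructor
    · rintro ⟨s, u, rfl, hs, hu⟩ v (hv | hv)
      exacts [Or.inl (hs v hv), Or.inr (hu v hv)]
    · intro H
      refine ⟨{v ∈ t | α.CSat v}, {v ∈ t | β.CSat v}, ?_, fun v hv => hv.2, fun v hv => hv.2⟩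
      rw [← Set.sep_or]
      exact (Set.sep_eq_self_iff_mem_true.2 H).symm
  | idisj => exact h.elim

theorem finite_svars (φ : Form) (b : Bool) : (φ.svars b).Finite := by
  induction φ generalizing b with
  | var => cases b <;> simp [svars]
  | bot => exact Set.finite_empty
  | neg _ ih => exact ih _
  | conj _ _ ih₁ ih₂ | disj _ _ ih₁ ih₂ | idisj _ _ ih₁ ih₂ => exact (ih₁ b).union (ih₂ b)

/-- Truth of `α` is preserved when signed variables of `α` are. -/
theorem CSat.mono {α : Form} {v u : Val} (hv : α.CSat v)
    (h : ∀ b, ∀ p ∈ α.svars b, v p = b → u p = b) : α.CSat u := by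
  induction α generalizing v u with
  | var p => exact h true p (by simp [svars]) hv
  | bot | idisj => exact hv.elim
  | neg α ih =>
    refine fun hu => hv (ih hu fun b p hp hup => ?_)
    have := h (!b) p (by simpa [svars] using hp)
    cases b <;> cases hvp : v p <;> simp_all
  | conj α β ihα ihβ =>
    exact ⟨ihα hv.1 fun b p hp => h b p (Or.inl hp), ihβ hv.2 fun b p hp => h b p (Or.inr hp)⟩
  | disj α β ihα ihβ =>
    exact hv.imp (ihα · fun b p hp => h b p (Or.inl hp)) (ihβ · fun b p hp => h b p (Or.inr hp))

/-- The literal `p` or `¬p`, according to the sign. -/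
def lit : ℕ × Bool → Form
  | (p, true) => var p
  | (p, false) => neg (var p)

theorem isClassical_lit (l : ℕ × Bool) : (lit l).IsClassical := by
  rcases l with ⟨p, _ | _⟩ <;> trivial

theorem cSat_lit (l : ℕ × Bool) (v : Val) : (lit l).CSat v ↔ v l.1 = l.2 := by
  rcases l with ⟨p, _ | _⟩ <;> simp [lit, CSat]

theorem svars_lit {l : ℕ × Bool} {b : Bool} {p : ℕ} (h : p ∈ (lit l).svars b) : l = (p, b) := by
  rcases l with ⟨q, _ | _⟩ <;> cases b <;> simp_all [lit, svars]

/-- Finite conjunction. -/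
def listConj (L : List Form) : Form := L.foldr conj (neg bot)

/-- Finite split disjunction. -/
def listDisj (L : List Form) : Form := L.foldr disj bot

/-- Finite inquisitive disjunction. -/
def listIdisj (L : List Form) : Form := L.foldr idisj bot

theorem isClassical_listConj {L : List Form} (h : ∀ α ∈ L, α.IsClassical) :
    (listConj L).IsClassical := by
  induction L with
  | nil => trivial
  | cons α L ih => exact ⟨h α (by simp), ih fun β hβ => h β (by simp [hβ])⟩

theorem isClassical_listDisj {L : List Form} (h : ∀ α ∈ L, α.IsClassical) :
    (listDisj L).IsClassical := by
  induction L with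
  | nil => trivial
  | cons α L ih => exact ⟨h α (by simp), ih fun β hβ => h β (by simp [hβ])⟩

theorem wf_listIdisj {L : List Form} (h : ∀ α ∈ L, α.WF) : (listIdisj L).WF := by
  induction L with
  | nil => trivial
  | cons α L ih => exact ⟨h α (by simp), ih fun β hβ => h β (by simp [hβ])⟩

theorem cSat_listConj (L : List Form) (v : Val) :
    (listConj L).CSat v ↔ ∀ α ∈ L, α.CSat v := by
  induction L with
  | nil => simp [listConj, CSat]
  | cons α L ih =>
    rw [List.forall_mem_cons, ← ih]
    rfl

theorem cSat_listDisj (L : List Form) (v : Val) :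
    (listDisj L).CSat v ↔ ∃ α ∈ L, α.CSat v := by
  induction L with
  | nil => simp [listDisj, CSat]
  | cons α L ih =>
    rw [List.exists_mem_cons_iff, ← ih]
    rfl

theorem sat_listIdisj (L : List Form) (t : Team) :
    (listIdisj L).Sat t ↔ t = ∅ ∨ ∃ α ∈ L, α.Sat t := by
  induction L with
  | nil => simp [listIdisj, Sat]
  | cons α L ih =>
    rw [List.exists_mem_cons_iff, or_left_comm, ← ih]
    rfl

theorem svars_listConj {L : List Form} {b : Bool} {p : ℕ} (h : p ∈ (listConj L).svars b) :
    ∃ α ∈ L, p ∈ α.svars b := by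
  induction L with
  | nil => exact h.elim
  | cons α L ih => exact (List.exists_mem_cons_iff _ _ _).2 (h.imp id ih)

theorem svars_listDisj {L : List Form} {b : Bool} {p : ℕ} (h : p ∈ (listDisj L).svars b) :
    ∃ α ∈ L, p ∈ α.svars b := by
  induction L with
  | nil => exact h.elim
  | cons α L ih => exact (List.exists_mem_cons_iff _ _ _).2 (h.imp id ih)

theorem svars_listIdisj {L : List Form} {b : Bool} {p : ℕ} (h : p ∈ (listIdisj L).svars b) :
    ∃ α ∈ L, p ∈ α.svars b := by
  induction L with
  | nil => exact h.elim
  | cons α L ih => exact (List.exists_mem_cons_iff _ _ _).2 (h.imp id ih)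

/-- The conjunction of the literals in `L` that are true under `v`. -/
noncomputable def diagram (L : Finset (ℕ × Bool)) (v : Val) : Form :=
  listConj ((L.filter fun l => v l.1 = l.2).toList.map lit)

theorem isClassical_diagram (L : Finset (ℕ × Bool)) (v : Val) : (diagram L v).IsClassical := by
  refine isClassical_listConj fun α hα => ?_
  obtain ⟨l, -, rfl⟩ := List.mem_map.1 hα
  exact isClassical_lit l

theorem cSat_diagram (L : Finset (ℕ × Bool)) (v w : Val) :
    (diagram L v).CSat w ↔ ∀ l ∈ L, v l.1 = l.2 → w l.1 = l.2 := by
  simp only [diagram, cSat_listConj, List.forall_mem_map, cSat_lit, Finset.mem_toList,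
    Finset.mem_filter, and_imp]

theorem svars_diagram {L : Finset (ℕ × Bool)} {v : Val} {b : Bool} {p : ℕ}
    (h : p ∈ (diagram L v).svars b) : (p, b) ∈ L := by
  obtain ⟨α, hα, hp⟩ := svars_listConj h
  obtain ⟨l, hl, rfl⟩ := List.mem_map.1 hα
  rw [← svars_lit hp]
  exact (Finset.mem_filter.1 (Finset.mem_toList.1 hl)).1

theorem finite_range_diagram (L : Finset (ℕ × Bool)) : (Set.range (diagram L)).Finite := by
  refine (L.powerset.finite_toSet.image fun S => listConj (S.toList.map lit)).subset ?_
  rintro _ ⟨v, rfl⟩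
  exact ⟨L.filter fun l => v l.1 = l.2, Finset.mem_powerset.2 (L.filter_subset _), rfl⟩

/-- Lyndon interpolation for classical propositional logic. -/
theorem exists_classical_interpolant {α β : Form} (h : ∀ v, α.CSat v → β.CSat v) :
    ∃ γ : Form, γ.IsClassical ∧ (∀ v, α.CSat v → γ.CSat v) ∧ (∀ v, γ.CSat v → β.CSat v) ∧
      ∀ b, γ.svars b ⊆ α.svars b ∩ β.svars b := by
  classical
  have hfin : {l : ℕ × Bool | l.1 ∈ α.svars l.2 ∩ β.svars l.2}.Finite := by
    refine (((α.finite_svars true).union (α.finite_svars false)).prod Set.finite_univ).subset ?_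
    rintro ⟨p, _ | _⟩ hp
    exacts [⟨Or.inr hp.1, trivial⟩, ⟨Or.inl hp.1, trivial⟩]
  obtain ⟨L, hL⟩ := hfin.exists_finset
  have hS : (diagram L '' {v | α.CSat v}).Finite :=
    (finite_range_diagram L).subset (Set.image_subset_range _ _)
  refine ⟨listDisj hS.toFinset.toList, isClassical_listDisj ?_, fun v hv => ?_, fun w hw => ?_,
    fun b p hp => ?_⟩
  · intro δ hδ
    obtain ⟨v, -, rfl⟩ := by simpa using hδ
    exact isClassical_diagram L v
  · refine (cSat_listDisj _ _).2 ⟨diagram L v, ?_, (cSat_diagram L v v).2 fun _ _ => id⟩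
    simpa using ⟨v, hv, rfl⟩
  · obtain ⟨δ, hδ, hw⟩ := (cSat_listDisj _ _).1 hw
    obtain ⟨v, hv, rfl⟩ : ∃ v, α.CSat v ∧ diagram L v = δ := by simpa using hδ
    rw [cSat_diagram] at hw
    -- a valuation between `v` and `w`, agreeing with `v` on what `α` sees
    let u : Val := fun p => if p ∈ α.svars (v p) then v p else w p
    have hu : α.CSat u := by
      refine hv.mono fun b p hp hvp => ?_
      subst hvp
      exact if_pos hp
    refine (h u hu).mono fun b p hp hup => ?_
    by_cases hpα : p ∈ α.svars (v p)
    · have hvp : v p = b := by simpa [u, hpα] using hup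
      exact hw (p, b) ((hL _).2 ⟨hvp ▸ hpα, hp⟩) hvp
    · simpa [u, hpα] using hup
  · obtain ⟨δ, hδ, hp⟩ := svars_listDisj hp
    obtain ⟨v, -, rfl⟩ : ∃ v, α.CSat v ∧ diagram L v = δ := by simpa using hδ
    exact (hL _).1 (svars_diagram hp)

theorem IsClassical.res_eq {α : Form} (h : α.IsClassical) : α.res = {α} := by
  induction α with
  | var | bot => rfl
  | neg α ih => simp [res, ih h]
  | conj α β ihα ihβ | disj α β ihα ihβ => simp [res, ihα h.1, ihβ h.2]
  | idisj => exact h.elim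

theorem finite_res (φ : Form) : φ.res.Finite := by
  induction φ with
  | var | bot => exact Set.finite_singleton _
  | neg _ ih => exact ih.image _
  | conj _ _ ih₁ ih₂ | disj _ _ ih₁ ih₂ => exact ih₁.image2 _ ih₂
  | idisj _ _ ih₁ ih₂ => exact ih₁.union ih₂

theorem WF.isClassical_of_mem_res {φ α : Form} (h : φ.WF) (hα : α ∈ φ.res) :
    α.IsClassical := by
  induction φ generalizing α with
  | var | bot => subst hα; trivial
  | neg β =>
    rw [IsClassical.res_eq (α := neg β) h] at hα
    subst hα
    exact h
  | conj φ ψ ihφ ihψ | disj φ ψ ihφ ihψ =>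
    obtain ⟨β, hβ, γ, hγ, rfl⟩ := hα
    exact ⟨ihφ h.1 hβ, ihψ h.2 hγ⟩
  | idisj φ ψ ihφ ihψ => exact hα.elim (ihφ h.1) (ihψ h.2)

theorem svars_subset_of_mem_res {φ α : Form} (hα : α ∈ φ.res) (b : Bool) :
    α.svars b ⊆ φ.svars b := by
  induction φ generalizing α b with
  | var | bot => subst hα; rfl
  | neg φ ih =>
    obtain ⟨β, hβ, rfl⟩ := hα
    exact ih hβ _
  | conj φ ψ ihφ ihψ | disj φ ψ ihφ ihψ =>
    obtain ⟨β, hβ, γ, hγ, rfl⟩ := hα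
    exact Set.union_subset_union (ihφ hβ b) (ihψ hγ b)
  | idisj φ ψ ihφ ihψ =>
    exact hα.elim (fun h => (ihφ h b).trans Set.subset_union_left)
      (fun h => (ihψ h b).trans Set.subset_union_right)

/-- A formula is equivalent to the inquisitive disjunction of its resolutions. -/
theorem WF.sat_iff_exists_res {φ : Form} (h : φ.WF) (t : Team) :
    φ.Sat t ↔ ∃ α ∈ φ.res, α.Sat t := by
  induction φ generalizing t with
  | var | bot => simp [res]
  | neg β => simp [IsClassical.res_eq (α := neg β) h]
  | conj φ ψ ihφ ihψ =>
    simp only [Sat, res, ihφ h.1, ihψ h.2, Set.exists_mem_image2]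
    exact ⟨fun ⟨⟨α, hα, h₁⟩, β, hβ, h₂⟩ => ⟨α, hα, β, hβ, h₁, h₂⟩,
      fun ⟨α, hα, β, hβ, h₁, h₂⟩ => ⟨⟨α, hα, h₁⟩, β, hβ, h₂⟩⟩
  | disj φ ψ ihφ ihψ =>
    simp only [Sat, res, ihφ h.1, ihψ h.2, Set.exists_mem_image2]
    exact ⟨fun ⟨s, u, ht, ⟨α, hα, h₁⟩, β, hβ, h₂⟩ => ⟨α, hα, β, hβ, s, u, ht, h₁, h₂⟩,
      fun ⟨α, hα, β, hβ, s, u, ht, h₁, h₂⟩ => ⟨s, u, ht, ⟨α, hα, h₁⟩, β, hβ, h₂⟩⟩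
  | idisj φ ψ ihφ ihψ =>
    simp only [Sat, res, ihφ h.1, ihψ h.2, Set.mem_union, or_and_right, exists_or]

/-- A classical formula entailing `ψ` entails a resolution of `ψ`, with a classical interpolant. -/
theorem IsClassical.exists_interpolant {α ψ : Form} (hα : α.IsClassical) (hψ : ψ.WF)
    (h : ∀ t, α.Sat t → ψ.Sat t) :
    ∃ γ : Form, γ.WF ∧ (∀ t, α.Sat t → γ.Sat t) ∧ (∀ t, γ.Sat t → ψ.Sat t) ∧
      ∀ b, γ.svars b ⊆ α.svars b ∩ ψ.svars b := by
  obtain ⟨β, hβ, hsat⟩ := (hψ.sat_iff_exists_res _).1 (h {v | α.CSat v}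
    ((hα.sat_iff _).2 fun _ hv => hv))
  have hβc := hψ.isClassical_of_mem_res hβ
  obtain ⟨γ, hγ, h₁, h₂, hvars⟩ := exists_classical_interpolant ((hβc.sat_iff _).1 hsat)
  refine ⟨γ, hγ.wf, fun t ht => ?_, fun t ht => ?_, fun b => ?_⟩
  · exact (hγ.sat_iff t).2 fun v hv => h₁ v ((hα.sat_iff t).1 ht v hv)
  · exact (hψ.sat_iff_exists_res t).2
      ⟨β, hβ, (hβc.sat_iff t).2 fun v hv => h₂ v ((hγ.sat_iff t).1 ht v hv)⟩
  · exact (hvars b).trans (Set.inter_subset_inter_right _ (svars_subset_of_mem_res hβ b))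

end Form

/-- Craig's and Lyndon's interpolation for PL(∨∨): if φ ⊨ ψ
then there is an interpolant θ with φ ⊨ θ ⊨ ψ, P⁺(θ) ⊆ P⁺(φ) ∩ P⁺(ψ) and
P⁻(θ) ⊆ P⁻(φ) ∩ P⁻(ψ). -/
theorem lyndon_interpolation (φ ψ : Form) (hφ : φ.WF) (hψ : ψ.WF)
    (h : ∀ t : Team, Form.Sat φ t → Form.Sat ψ t) :
    ∃ θ : Form, θ.WF ∧
      (∀ t : Team, Form.Sat φ t → Form.Sat θ t) ∧
      (∀ t : Team, Form.Sat θ t → Form.Sat ψ t) ∧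
      Form.pvars θ ⊆ Form.pvars φ ∩ Form.pvars ψ ∧
      Form.nvars θ ⊆ Form.nvars φ ∩ Form.nvars ψ := by
  have hex : ∀ α : φ.res, ∃ γ : Form, γ.WF ∧ (∀ t, α.1.Sat t → γ.Sat t) ∧
      (∀ t, γ.Sat t → ψ.Sat t) ∧ ∀ b, γ.svars b ⊆ α.1.svars b ∩ ψ.svars b := fun α =>
    (hφ.isClassical_of_mem_res α.2).exists_interpolant hψ fun t ht =>
      h t ((hφ.sat_iff_exists_res t).2 ⟨α.1, α.2, ht⟩)
  choose g hwf hleft hright hvars using hex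
  have : Finite φ.res := φ.finite_res
  have hfin : (Set.range g).Finite := Set.finite_range g
  have hmem : ∀ γ, γ ∈ hfin.toFinset.toList ↔ ∃ α, g α = γ := by simp
  have hsub : ∀ b, (Form.listIdisj hfin.toFinset.toList).svars b ⊆ φ.svars b ∩ ψ.svars b := by
    intro b p hp
    obtain ⟨γ, hγ, hp⟩ := Form.svars_listIdisj hp
    obtain ⟨α, rfl⟩ := (hmem γ).1 hγ
    have := hvars α b hp
    exact ⟨Form.svars_subset_of_mem_res α.2 b this.1, this.2⟩
  refine ⟨Form.listIdisj hfin.toFinset.toList, Form.wf_listIdisj fun γ hγ => ?_,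
    fun t ht => ?_, fun t ht => ?_, hsub true, hsub false⟩
  · obtain ⟨α, rfl⟩ := (hmem γ).1 hγ
    exact hwf α
  · obtain ⟨α, hα, ht⟩ := (hφ.sat_iff_exists_res t).1 ht
    exact (Form.sat_listIdisj _ t).2
      (Or.inr ⟨g ⟨α, hα⟩, (hmem _).2 ⟨_, rfl⟩, hleft ⟨α, hα⟩ t ht⟩)
  · obtain rfl | ⟨γ, hγ, ht⟩ := (Form.sat_listIdisj _ t).1 ht
    · exact ψ.sat_empty
    · obtain ⟨α, rfl⟩ := (hmem γ).1 hγ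
      exact hright α t ht
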